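/- arXiv:1011.6338 — 3 statements merged into one kernel-verified Lean document; each statement's English description precedes it below -/
import Mathlib

section
/- For each integer $j \geq 1$ let $c_j = \frac{72^{j-1}\,\Gamma(\tfrac{3j}{2}-1)}{2\,\Gamma(j)\,\Gamma(\tfrac{j}{2}+1)}$, where $\Gamma$ is the Euler Gamma function. Then for every complex number $w$ with $|w| < \frac{\sqrt{3}}{324}$, the series $v(w) = \sum_{j=1}^{\infty} c_j w^j$ converges absolutely, and its sum satisfies the cubic equation $72\, v(w)^3 - v(w)^2 + w^2 = 0$. -/
/-- Taylor coefficients `c_j = 72^{j-1} Γ(3j/2 - 1) / (2 Γ(j) Γ(j/2 + 1))` of the branch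
`v(w)` of `72 v³ - v² + w² = 0` analytic at `w = 0`. -/
noncomputable def cCoeff (j : ℕ) : ℝ :=
  72 ^ (j - 1) * Real.Gamma (3 * j / 2 - 1) / (2 * Real.Gamma j * Real.Gamma (j / 2 + 1))

open PowerSeries in
lemma exists_series : ∃ V : PowerSeries ℂ, coeff 0 V = 0 ∧ coeff 1 V = 1 ∧
    72 * V ^ 3 - V ^ 2 + X ^ 2 = 0 := by
  have hH : HenselianRing (PowerSeries ℂ) (Ideal.span {(X : PowerSeries ℂ)}) := inferInstance
  let f : Polynomial (PowerSeries ℂ) :=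
    Polynomial.X ^ 3 + (- Polynomial.X + Polynomial.C (72 * X))
  have hdeg : (- Polynomial.X + Polynomial.C (72 * X) : Polynomial (PowerSeries ℂ)).degree < 3 := by
    refine lt_of_le_of_lt (Polynomial.degree_add_le _ _) ?_
    rw [max_lt_iff, Polynomial.degree_neg, Polynomial.degree_X]
    refine ⟨by norm_num, lt_of_le_of_lt Polynomial.degree_C_le (by norm_num)⟩
  have hf : f.Monic := Polynomial.monic_X_pow_add hdeg
  obtain ⟨t, ht, ht1⟩ := hH.is_henselian f hf 1 (by
    simp only [f, Polynomial.eval_add, Polynomial.eval_pow, Polynomial.eval_X, Polynomial.eval_neg,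
      Polynomial.eval_C]
    refine Ideal.mem_span_singleton.2 ⟨72, by ring⟩) (by
    have : Polynomial.eval 1 (Polynomial.derivative f) = C (2 : ℂ) := by
      simp only [f, Polynomial.derivative_add, Polynomial.derivative_X_pow,
        Polynomial.derivative_neg, Polynomial.derivative_X, Polynomial.derivative_C,
        Polynomial.eval_add, Polynomial.eval_mul, Polynomial.eval_pow, Polynomial.eval_X,
        Polynomial.eval_neg, Polynomial.eval_one, Polynomial.eval_natCast, Polynomial.eval_C,
        Polynomial.eval_zero]
      rw [map_ofNat]
      norm_num
    rw [this]
    exact (((IsUnit.mk0 (2 : ℂ) two_ne_zero).map (C (R := ℂ))).map _))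
  have ht : t ^ 3 - t + 72 * X = 0 := by
    have := ht
    simp only [Polynomial.IsRoot, f, Polynomial.eval_add, Polynomial.eval_pow, Polynomial.eval_X,
      Polynomial.eval_neg, Polynomial.eval_C] at this
    linear_combination this
  have hc : constantCoeff t = 1 := by
    obtain ⟨u, hu⟩ := Ideal.mem_span_singleton.1 ht1
    have := congrArg constantCoeff hu
    simp at this
    linear_combination this
  have hinv : t * t⁻¹ = 1 := PowerSeries.mul_inv_cancel t (by simp [hc])
  refine ⟨X * t⁻¹, by simp, ?_, ?_⟩
  · rw [show (1 : ℕ) = 0 + 1 from rfl, coeff_succ_X_mul]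
    simp [hc]
  · generalize t⁻¹ = s at hinv
    have h3 : X ^ 2 * s ^ 3 * (t ^ 3 - t + 72 * X) = 0 := by rw [ht, mul_zero]
    linear_combination h3 + (X ^ 2 * s ^ 2 - X ^ 2 * (t ^ 2 * s ^ 2 + t * s + 1)) * hinv

open PowerSeries in
lemma series_ode (V : PowerSeries ℂ) (h0 : coeff 0 V = 0) (h1 : coeff 1 V = 1)
    (h : 72 * V ^ 3 - V ^ 2 + X ^ 2 = 0) :
    d⁄dX ℂ (d⁄dX ℂ V) - 34992 * X ^ 2 * d⁄dX ℂ (d⁄dX ℂ V) - 34992 * X * d⁄dX ℂ V + 15552 * V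
      - 72 = 0 := by
  have hn : ∀ n : ℕ, [n.AtLeastTwo] → d⁄dX ℂ (OfNat.ofNat n : PowerSeries ℂ) = 0 := by
    intro n _
    exact (d⁄dX ℂ).map_natCast n
  have hV : V ≠ 0 := by
    rintro rfl
    simp at h1
  have hP1 : (1 - 108 * V : PowerSeries ℂ) ≠ 0 := by
    intro hh
    have := congrArg constantCoeff hh
    rw [coeff_zero_eq_constantCoeff_apply] at h0
    simp [h0] at this
  have hd := congrArg (d⁄dX ℂ) h
  simp only [map_add, map_sub, map_zero, Derivation.leibniz, Derivation.leibniz_pow, hn,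
    derivative_X, smul_eq_mul, nsmul_eq_mul] at hd
  have e1 : V * (1 - 108 * V) * d⁄dX ℂ V = X := by
    have h2 : (2 : PowerSeries ℂ) ≠ 0 := by
      rw [← map_ofNat (C (R := ℂ)) 2]
      exact (map_ne_zero_iff _ C_injective).2 two_ne_zero
    apply mul_left_cancel₀ h2
    push_cast at hd
    linear_combination -hd
  have hd2 := congrArg (d⁄dX ℂ) e1
  simp only [map_add, map_sub, Derivation.leibniz, hn, Derivation.map_one_eq_zero,
    derivative_X, smul_eq_mul] at hd2
  generalize d⁄dX ℂ (d⁄dX ℂ V) = B at *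
  generalize d⁄dX ℂ V = A at *
  have hP : (V * (1 - 108 * V)) ^ 3 ≠ 0 := pow_ne_zero _ (mul_ne_zero hV hP1)
  apply (mul_eq_zero.1 (?_ : (V * (1 - 108 * V)) ^ 3 * _ = 0)).resolve_left hP
  have eA2 : (V * (1 - 108 * V)) ^ 2 * A ^ 2 = X ^ 2 := by rw [← e1]; ring
  have hX : (X : PowerSeries ℂ) ^ 2 = V ^ 2 - 72 * V ^ 3 := by linear_combination h
  have eB : (V * (1 - 108 * V)) ^ 3 * B = (V * (1 - 108 * V)) ^ 2 - (1 - 216 * V) * X ^ 2 := by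
    linear_combination (V * (1 - 108 * V)) ^ 2 * hd2 - (1 - 216 * V) * eA2
  have eA : (V * (1 - 108 * V)) ^ 3 * (X * A) = (V * (1 - 108 * V)) ^ 2 * X ^ 2 := by
    linear_combination (V * (1 - 108 * V)) ^ 2 * X * e1
  have key : (V * (1 - 108 * V)) ^ 3 * (B - 34992 * X ^ 2 * B - 34992 * X * A + 15552 * V - 72)
    = (1 - 34992 * X ^ 2) * ((V * (1 - 108 * V)) ^ 2 - (1 - 216 * V) * X ^ 2)
      - 34992 * ((V * (1 - 108 * V)) ^ 2 * X ^ 2) + (15552 * V - 72) * (V * (1 - 108 * V)) ^ 3 := by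
    linear_combination (1 - 34992 * X ^ 2) * eB - 34992 * eA
  rw [key, hX]
  ring

open PowerSeries in
lemma series_rec (V : PowerSeries ℂ) (h0 : coeff 0 V = 0) (h1 : coeff 1 V = 1)
    (h : 72 * V ^ 3 - V ^ 2 + X ^ 2 = 0) :
    coeff 2 V = 36 ∧ ∀ j : ℕ, coeff (j + 3) V * ((j + 2) * (j + 3)) =
      3888 * (9 * (j + 1) ^ 2 - 4) * coeff (j + 1) V := by
  have ode := series_ode V h0 h1 h
  have hn : ∀ n : ℕ, [n.AtLeastTwo] → (OfNat.ofNat n : PowerSeries ℂ) = C (OfNat.ofNat n : ℂ) := by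
    intro n _
    exact (map_ofNat C n).symm
  constructor
  · have := congrArg (coeff 0) ode
    rw [hn 34992, hn 15552, hn 72] at this
    simp only [map_sub, map_add, mul_assoc, coeff_C_mul, coeff_zero_X_mul, pow_two, coeff_derivative,
      coeff_zero_C, h0, map_zero] at this
    norm_num at this
    linear_combination this / 2
  · intro j
    have := congrArg (coeff (j + 1)) ode
    rw [hn 34992, hn 15552, hn 72] at this
    rcases j with _ | j
    · simp only [map_sub, map_add, mul_assoc, coeff_C_mul, coeff_succ_X_mul, coeff_zero_X_mul,
        pow_two, coeff_derivative, coeff_succ_C, map_zero] at this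
      norm_num at this ⊢
      linear_combination this
    · simp only [map_sub, map_add, mul_assoc, coeff_C_mul, coeff_succ_X_mul, coeff_zero_X_mul,
        pow_two, coeff_derivative, coeff_succ_C, map_zero] at this
      push_cast at this ⊢
      linear_combination this

lemma cCoeff_one : cCoeff 1 = 1 := by
  unfold cCoeff
  have : Real.Gamma (1 / 2 + 1) = 1 / 2 * Real.Gamma (1 / 2) := Real.Gamma_add_one (by norm_num)
  have h2 : Real.Gamma (1 / 2) ≠ 0 := (Real.Gamma_pos_of_pos (by norm_num)).ne'
  norm_num at this h2 ⊢
  rw [this]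
  field_simp

lemma cCoeff_two : cCoeff 2 = 36 := by
  unfold cCoeff
  norm_num [Real.Gamma_two, show (3 : ℝ) - 1 = 2 by norm_num]

lemma cCoeff_rec (j : ℕ) : cCoeff (j + 3) * ((j + 2) * (j + 3)) =
      3888 * (9 * (j + 1) ^ 2 - 4) * cCoeff (j + 1) := by
  unfold cCoeff
  have hj : (0 : ℝ) ≤ j := j.cast_nonneg
  push_cast
  have g1 : Real.Gamma (3 * ((j : ℝ) + 3) / 2 - 1) =
      (3 * ((j : ℝ) + 1) / 2 + 1) * ((3 * ((j : ℝ) + 1) / 2) * ((3 * ((j : ℝ) + 1) / 2 - 1) *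
        Real.Gamma (3 * ((j : ℝ) + 1) / 2 - 1))) := by
    rw [← Real.Gamma_add_one (by linarith : 0 < 3 * ((j : ℝ) + 1) / 2 - 1).ne', sub_add_cancel,
      ← Real.Gamma_add_one (by positivity), ← Real.Gamma_add_one (by positivity)]
    congr 1
    ring
  have g2 : Real.Gamma ((j : ℝ) + 3) =
      ((j : ℝ) + 2) * (((j : ℝ) + 1) * Real.Gamma ((j : ℝ) + 1)) := by
    rw [← Real.Gamma_add_one (by positivity), show (j : ℝ) + 1 + 1 = j + 2 by ring,
      ← Real.Gamma_add_one (by positivity)]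
    congr 1
    ring
  have g3 : Real.Gamma (((j : ℝ) + 3) / 2 + 1) =
      (((j : ℝ) + 1) / 2 + 1) * Real.Gamma (((j : ℝ) + 1) / 2 + 1) := by
    rw [← Real.Gamma_add_one (by positivity)]
    congr 1
    ring
  rw [g1, g2, g3]
  have p1 : 0 < Real.Gamma ((j : ℝ) + 1) := Real.Gamma_pos_of_pos (by positivity)
  have p2 : 0 < Real.Gamma (((j : ℝ) + 1) / 2 + 1) := Real.Gamma_pos_of_pos (by positivity)
  generalize Real.Gamma ((j : ℝ) + 1) = G1 at *
  generalize Real.Gamma (((j : ℝ) + 1) / 2 + 1) = G2 at *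
  generalize Real.Gamma (3 * ((j : ℝ) + 1) / 2 - 1) = G3 at *
  have q1 : (j : ℝ) + 1 ≠ 0 := by positivity
  have q2 : (j : ℝ) + 2 ≠ 0 := by positivity
  have q3 : ((j : ℝ) + 1) / 2 + 1 ≠ 0 := by positivity
  have q4 : (j : ℝ) + 1 + 2 ≠ 0 := by positivity
  rw [pow_add]
  field_simp
  ring

lemma two_step {P : ℕ → Prop} (h0 : P 0) (h1 : P 1) (h : ∀ n, P n → P (n + 2)) : ∀ n, P n := by
  intro n
  induction n using Nat.twoStepInduction with
  | zero => exact h0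
  | one => exact h1
  | more n a _ => exact h n a

lemma cCoeff_bound (ρ : ℝ) (hρ : 0 ≤ ρ) (hρ2 : ρ ^ 2 = 34992) (j : ℕ) :
    |cCoeff (j + 1)| ≤ ρ ^ (j + 1) := by
  induction j using two_step with
  | h0 => rw [cCoeff_one]; norm_num; nlinarith
  | h1 => norm_num [cCoeff_two, hρ2]
  | h j ih =>
    have hj : (0 : ℝ) ≤ j := j.cast_nonneg
    have hr := congrArg abs (cCoeff_rec j)
    rw [abs_mul, abs_mul (3888 * (9 * ((j : ℝ) + 1) ^ 2 - 4)), abs_of_nonneg (by positivity : (0 : ℝ) ≤ ((j : ℝ) + 2) * (j + 3)),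
      abs_of_nonneg (by nlinarith : (0 : ℝ) ≤ 3888 * (9 * ((j : ℝ) + 1) ^ 2 - 4))] at hr
    have hpos : (0 : ℝ) < ((j : ℝ) + 2) * (j + 3) := by positivity
    refine le_of_mul_le_mul_right ?_ hpos
    rw [show j + 2 + 1 = j + 3 from rfl, hr,
      show ρ ^ (j + 3) = ρ ^ 2 * ρ ^ (j + 1) by ring, hρ2]
    have : 3888 * (9 * ((j : ℝ) + 1) ^ 2 - 4) ≤ 34992 * (((j : ℝ) + 2) * (j + 3)) := by nlinarith
    calc _ ≤ 34992 * (((j : ℝ) + 2) * (j + 3)) * ρ ^ (j + 1) := by gcongr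
      _ = _ := by ring

open PowerSeries in
lemma coeff_eq (V : PowerSeries ℂ) (h0 : coeff 0 V = 0) (h1 : coeff 1 V = 1)
    (h : 72 * V ^ 3 - V ^ 2 + X ^ 2 = 0) (j : ℕ) : coeff (j + 1) V = (cCoeff (j + 1) : ℂ) := by
  obtain ⟨h2, hr⟩ := series_rec V h0 h1 h
  induction j using two_step with
  | h0 => rw [cCoeff_one, zero_add, h1]; simp
  | h1 => rw [cCoeff_two, h2]; simp
  | h j ih =>
    have hc := congrArg (Complex.ofReal) (cCoeff_rec j)
    push_cast at hc
    have hne : ((j : ℂ) + 2) * (j + 3) ≠ 0 := by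
      norm_cast
    apply mul_right_cancel₀ hne
    rw [show j + 2 + 1 = j + 3 from rfl, hc, hr, ih]

open PowerSeries in
lemma eval_mul (w : ℂ) (F G : PowerSeries ℂ) (hF : Summable fun n => ‖coeff n F * w ^ n‖)
    (hG : Summable fun n => ‖coeff n G * w ^ n‖) :
    (Summable fun n => ‖coeff n (F * G) * w ^ n‖) ∧
    ∑' n, coeff n (F * G) * w ^ n = (∑' n, coeff n F * w ^ n) * ∑' n, coeff n G * w ^ n := by
  have e : ∀ n, coeff n (F * G) * w ^ n = ∑ kl ∈ Finset.HasAntidiagonal.antidiagonal n,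
      (coeff kl.1 F * w ^ kl.1) * (coeff kl.2 G * w ^ kl.2) := by
    intro n
    rw [coeff_mul, Finset.sum_mul]
    refine Finset.sum_congr rfl fun kl hkl => ?_
    rw [← Finset.HasAntidiagonal.mem_antidiagonal.1 hkl, pow_add]
    ring
  simp only [e]
  exact ⟨summable_norm_sum_mul_antidiagonal_of_summable_norm
      (f := fun n => coeff n F * w ^ n) (g := fun n => coeff n G * w ^ n) hF hG,
    (tsum_mul_tsum_eq_tsum_sum_antidiagonal_of_summable_norm
      (f := fun n => coeff n F * w ^ n) (g := fun n => coeff n G * w ^ n) hF hG).symm⟩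

open PowerSeries in
/-- For `|w| < √3/324`, the series `v(w) = ∑_{j≥1} c_j w^j` converges absolutely and its sum
satisfies the cubic equation `72 v(w)³ - v(w)² + w² = 0`. -/
theorem stmt1 (w : ℂ) (hw : ‖w‖ < Real.sqrt 3 / 324) :
    Summable (fun j : ℕ => ‖(cCoeff (j + 1) : ℂ) * w ^ (j + 1)‖) ∧
    72 * (∑' j : ℕ, (cCoeff (j + 1) : ℂ) * w ^ (j + 1)) ^ 3
      - (∑' j : ℕ, (cCoeff (j + 1) : ℂ) * w ^ (j + 1)) ^ 2 + w ^ 2 = 0 := by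
  have hs3 : Real.sqrt 3 * Real.sqrt 3 = 3 := Real.mul_self_sqrt (by norm_num)
  have hs0 : 0 < Real.sqrt 3 := Real.sqrt_pos.2 (by norm_num)
  have hsum : Summable (fun j : ℕ => ‖(cCoeff (j + 1) : ℂ) * w ^ (j + 1)‖) := by
    have hlt : 108 * Real.sqrt 3 * ‖w‖ < 1 := by nlinarith
    have hg := (summable_nat_add_iff 1).2
      (summable_geometric_of_lt_one (r := 108 * Real.sqrt 3 * ‖w‖) (by positivity) hlt)
    refine Summable.of_nonneg_of_le (fun _ => norm_nonneg _) (fun j => ?_) hg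
    rw [norm_mul, norm_pow, mul_pow _ ‖w‖, Complex.norm_real, Real.norm_eq_abs]
    gcongr
    exact cCoeff_bound _ (by positivity) (by nlinarith) j
  refine ⟨hsum, ?_⟩
  obtain ⟨V, h0, h1, hV⟩ := exists_series
  simp only [← coeff_eq V h0 h1 hV] at hsum ⊢
  have hS : Summable fun n => ‖coeff n V * w ^ n‖ :=
    (summable_nat_add_iff (f := fun n => ‖coeff n V * w ^ n‖) 1).1 hsum
  have hE : ∑' n, coeff n V * w ^ n = ∑' j, coeff (j + 1) V * w ^ (j + 1) := by
    rw [hS.of_norm.tsum_eq_zero_add]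
    simp [h0]
  rw [← hE]
  obtain ⟨s2, e2⟩ := eval_mul w V V hS hS
  obtain ⟨s3, e3⟩ := eval_mul w (V * V) V s2 hS
  rw [e2] at e3
  have hX : HasSum (fun n => coeff n (X ^ 2 : PowerSeries ℂ) * w ^ n) (w ^ 2) := by
    convert hasSum_single (f := fun n => coeff n (X ^ 2 : PowerSeries ℂ) * w ^ n) 2 ?_ using 1
    · simp [coeff_X_pow]
    · intro n hn
      simp [coeff_X_pow, hn]
  have t2 := s2.of_norm.hasSum
  have t3 := s3.of_norm.hasSum
  rw [e2] at t2
  rw [e3] at t3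
  have tot := ((t3.mul_left 72).sub t2).add hX
  have hz : ∀ n, 72 * (coeff n (V * V * V) * w ^ n) - coeff n (V * V) * w ^ n
      + coeff n (X ^ 2 : PowerSeries ℂ) * w ^ n = 0 := by
    intro n
    have := congrArg (coeff n) hV
    rw [show (72 : PowerSeries ℂ) = C (72 : ℂ) from (map_ofNat C 72).symm, map_add, map_sub,
      coeff_C_mul, map_zero, pow_three', pow_two V] at this
    linear_combination w ^ n * this
  simp only [hz] at tot
  have := tot.unique hasSum_zero
  linear_combination this
end

section
/- Let $u_c = \frac{3^{1/4}}{18}$, let $s > 0$ be a real number, and for each integer $j \geq 0$ let $a_{2j}(s) = \frac{72^j\, s^{j+1}\,\Gamma(\tfrac{3j+1}{2})}{2\,\Gamma(j+1)\,\Gamma(\tfrac{j+3}{2})}$, where $\Gamma$ is the Euler Gamma function. Then for every complex number $u$ with $|u| < u_c\, s^{-1/2}$, the series $g_0(s,u) = \sum_{j=0}^{\infty} a_{2j}(s)\, u^{2j}$ converges absolutely and its sum satisfies $72u^2\, g_0(s,u)^3 - g_0(s,u)^2 + s^2 = 0$. -/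
/-- Taylor coefficients `a_{2j}(s) = 72^j s^{j+1} Γ((3j+1)/2) / (2 Γ(j+1) Γ((j+3)/2))`. -/
noncomputable def aCoeff (s : ℝ) (j : ℕ) : ℝ :=
  72 ^ j * s ^ (j + 1) * Real.Gamma ((3 * j + 1) / 2) /
    (2 * Real.Gamma (j + 1) * Real.Gamma ((j + 3) / 2))

open PowerSeries in
/-- formal solution of `X H^3 - H^2 + 1 = 0` -/
theorem exists_formal : ∃ H : PowerSeries ℂ, coeff 0 H = 1 ∧ X * H ^ 3 - H ^ 2 + 1 = 0 := by
  let Φ : PowerSeries ℂ → PowerSeries ℂ := fun w => C (1/2 : ℂ) * (X * (1 + w) ^ 3 - w ^ 2)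
  have hX : ∀ w, X ∣ w → X ∣ Φ w := by
    rintro w ⟨v, rfl⟩
    exact ⟨C (1/2 : ℂ) * ((1 + X * v) ^ 3 - X * v ^ 2), by simp only [Φ]; ring⟩
  have hc : ∀ k w v, X ∣ w → X ∣ v → X ^ k ∣ w - v → X ^ (k+1) ∣ Φ w - Φ v := by
    rintro k w v ⟨a, rfl⟩ ⟨b, rfl⟩ ⟨d, hd⟩
    refine ⟨C (1/2 : ℂ) * (d * ((1 + X * a)^2 + (1 + X * a) * (1 + X * b) + (1 + X * b)^2) - d * (a + b)), ?_⟩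
    simp only [Φ]
    linear_combination (C (1/2 : ℂ) * (X * ((1 + X * a)^2 + (1 + X * a) * (1 + X * b) + (1 + X * b)^2) - X * (a + b))) * hd
  let p : ℕ → PowerSeries ℂ := fun n => Φ^[n] 0
  have hp : ∀ n, p (n+1) = Φ (p n) := fun n => Function.iterate_succ_apply' Φ n 0
  have hpX : ∀ n, X ∣ p n := by
    intro n
    induction n with
    | zero => exact dvd_zero _
    | succ n ih => rw [hp]; exact hX _ ih
  have hd : ∀ n, X ^ (n+1) ∣ p (n+1) - p n := by
    intro n
    induction n with
    | zero => simpa [p] using hX 0 (dvd_zero _)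
    | succ n ih => rw [hp (n+1)]; nth_rewrite 2 [hp n]; exact hc _ _ _ (hpX _) (hpX _) ih
  have hd2 : ∀ n m, X ^ (n+1) ∣ p (n+m) - p n := by
    intro n m
    induction m with
    | zero => simp
    | succ m ih =>
      have h1 : X ^ (n+1) ∣ p (n+m+1) - p (n+m) :=
        (pow_dvd_pow X (by omega)).trans (hd (n+m))
      have := dvd_add h1 ih
      simpa [add_assoc] using this
  let W : PowerSeries ℂ := PowerSeries.mk fun n => coeff n (p n)
  have hW : ∀ n, X ^ (n+1) ∣ W - p n := by
    intro n
    rw [PowerSeries.X_pow_dvd_iff]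
    intro m hm
    obtain ⟨k, rfl⟩ : ∃ k, n = m + k := ⟨n - m, by omega⟩
    have := (PowerSeries.X_pow_dvd_iff.1 (hd2 m k)) m (by omega)
    rw [map_sub] at this ⊢
    simp only [W, coeff_mk]
    linear_combination -this
  have hWX : X ∣ W := by
    have h0 := hW 0
    simpa [p] using h0
  have hfix : W = Φ W := by
    rw [← sub_eq_zero]
    ext n
    have h1 := hW (n+1)
    have h2 := hc _ _ _ hWX (hpX n) (hW n)
    rw [← hp] at h2
    have h3 := dvd_sub h1 h2
    have h4 := (PowerSeries.X_pow_dvd_iff.1 h3) n (by omega)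
    simpa using h4
  refine ⟨1 + W, ?_, ?_⟩
  · obtain ⟨v, hv⟩ := hWX
    rw [hv]; simp
  · have h2 : (C (1/2 : ℂ) : PowerSeries ℂ) * 2 = 1 := by
      have : (2 : PowerSeries ℂ) = C (2 : ℂ) := (map_ofNat C 2).symm
      rw [this, ← map_mul]; norm_num
    simp only [Φ] at hfix
    linear_combination (-2) * hfix - (X * (1+W)^3 - W^2) * h2

open PowerSeries in
theorem formal_ode (H : PowerSeries ℂ) (h0 : coeff 0 H = 1) (hH : X * H ^ 3 - H ^ 2 + 1 = 0) :
    4 * X * (d⁄dX ℂ (d⁄dX ℂ H)) + 8 * d⁄dX ℂ H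
      = 3 * X * (9 * X ^ 2 * (d⁄dX ℂ (d⁄dX ℂ H)) + 27 * X * d⁄dX ℂ H + 5 * H) + 4 := by
  have hH0 : H ≠ 0 := by rintro rfl; simp at h0
  have hD0 : (3 - H ^ 2) ≠ 0 := by
    intro h
    have := congrArg (coeff 0) h
    have e : (3 : PowerSeries ℂ) = C (3 : ℂ) := (map_ofNat C 3).symm
    rw [coeff_zero_eq_constantCoeff_apply] at h0
    rw [e] at this
    simp [h0] at this
    norm_num at this
  have h1 := congrArg (d⁄dX ℂ) hH
  simp only [map_add, map_sub, Derivation.leibniz, Derivation.leibniz_pow, smul_eq_mul, derivative_X, map_zero, Derivation.map_one_eq_zero, nsmul_eq_mul] at h1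
  push_cast at h1
  norm_num at h1
  set A := d⁄dX ℂ H with hA
  have e1 : A * (3 - H ^ 2) = H ^ 4 := by
    linear_combination 3 * A * hH - H * h1
  have h2 := congrArg (d⁄dX ℂ) e1
  have d3 : d⁄dX ℂ (3 : PowerSeries ℂ) = 0 := by
    have : (3 : PowerSeries ℂ) = C (3 : ℂ) := (map_ofNat C 3).symm
    rw [this]; simp
  simp only [map_add, map_sub, Derivation.leibniz, Derivation.leibniz_pow, smul_eq_mul, map_zero, nsmul_eq_mul, d3, ← hA] at h2
  push_cast at h2
  norm_num at h2
  set B := d⁄dX ℂ A with hB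
  have e2 : B * (3 - H ^ 2) ^ 3 = 2 * H ^ 9 + 4 * H ^ 7 * (3 - H ^ 2) := by
    linear_combination (3 - H ^ 2) ^ 2 * h2 + (2 * H * (A * (3 - H ^ 2) + H ^ 4) + 4 * H ^ 3 * (3 - H ^ 2)) * e1
  have hq : X * H ^ 3 = H ^ 2 - 1 := by linear_combination hH
  rw [← sub_eq_zero]
  apply mul_right_cancel₀ (mul_ne_zero (pow_ne_zero 3 hD0) (pow_ne_zero 9 hH0))
  rw [zero_mul]
  calc _ = (4 * (X * H ^ 3) * H ^ 6 - 27 * (X * H ^ 3) ^ 3) * (B * (3 - H ^ 2) ^ 3)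
        + (8 * H ^ 9 - 81 * (X * H ^ 3) ^ 2 * H ^ 3) * (A * (3 - H ^ 2)) * (3 - H ^ 2) ^ 2
        - 15 * (X * H ^ 3) * H ^ 7 * (3 - H ^ 2) ^ 3 - 4 * H ^ 9 * (3 - H ^ 2) ^ 3 := by ring
    _ = 0 := by rw [e2, e1, hq]; ring

open PowerSeries in
theorem formal_rec (H : PowerSeries ℂ) (h0 : coeff 0 H = 1) (hH : X * H ^ 3 - H ^ 2 + 1 = 0) :
    coeff 1 H = 1 / 2 ∧ ∀ j : ℕ, 4 * ((j:ℂ)+2) * (j+3) * coeff (j+2) H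
      = 3 * (3 * j + 1) * (3 * j + 5) * coeff j H := by
  have h := formal_ode H h0 hH
  have key : ∀ n, coeff n (C (4:ℂ) * (X * (d⁄dX ℂ (d⁄dX ℂ H))) + C (8:ℂ) * d⁄dX ℂ H)
      = coeff n (C (27:ℂ) * (X * (X * (X * (d⁄dX ℂ (d⁄dX ℂ H))))) + C (81:ℂ) * (X * (X * d⁄dX ℂ H)) + C (15:ℂ) * (X * H) + C (4:ℂ)) := by
    intro n
    congr 1
    simp only [map_ofNat]
    linear_combination h
  constructor
  · have := key 0
    have h3 := coeff_derivative H 0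
    rw [coeff_zero_eq_constantCoeff_apply] at h3
    simp at this h3
    linear_combination this / 8 - h3
  · intro j
    have := key (j+1)
    rcases j with _ | _ | j
    · simp [coeff_derivative, coeff_succ_X_mul, coeff_C] at this
      norm_num at this ⊢
      linear_combination this
    · simp [coeff_derivative, coeff_succ_X_mul, coeff_C] at this
      norm_num at this ⊢
      linear_combination this
    · simp [coeff_derivative, coeff_succ_X_mul, coeff_C] at this
      push_cast at this ⊢
      linear_combination this

theorem c_zero : aCoeff 1 0 = 1 := by
  have h := Real.Gamma_add_one (s := 1/2) (by norm_num)
  have hp := Real.Gamma_pos_of_pos (s := 1/2) (by norm_num)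
  have e : (3:ℝ)/2 = 1/2+1 := by norm_num
  simp only [aCoeff]
  norm_num [Real.Gamma_one]
  rw [e, h]
  field_simp

theorem c_one : aCoeff 1 1 = 1 / 2 * 72 := by
  simp only [aCoeff]
  norm_num [Real.Gamma_two]

theorem c_pos (j : ℕ) : 0 < aCoeff 1 j := by
  unfold aCoeff
  have h1 := Real.Gamma_pos_of_pos (s := (3 * j + 1) / 2) (by positivity)
  have h2 := Real.Gamma_pos_of_pos (s := (j + 1)) (by positivity)
  have h3 := Real.Gamma_pos_of_pos (s := (j + 3) / 2) (by positivity)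
  positivity

theorem c_rec (j : ℕ) : 4 * ((j:ℝ)+2) * (j+3) * aCoeff 1 (j+2)
      = 3 * (3 * j + 1) * (3 * j + 5) * 72 ^ 2 * aCoeff 1 j := by
  have h1 := Real.Gamma_pos_of_pos (s := (3 * j + 1) / 2) (by positivity)
  have h2 := Real.Gamma_pos_of_pos (s := (j + 1)) (by positivity)
  have h3 := Real.Gamma_pos_of_pos (s := (j + 3) / 2) (by positivity)
  have g1 : Real.Gamma ((3 * ((j + 2 : ℕ):ℝ) + 1) / 2) = ((3*j+5)/2) * (((3*j+3)/2) * (((3*j+1)/2) * Real.Gamma ((3 * j + 1) / 2))) := by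
    rw [← Real.Gamma_add_one (by positivity), show ((3 * j + 1) / 2 : ℝ) + 1 = (3*j+3)/2 by ring,
      ← Real.Gamma_add_one (by positivity), show ((3 * j + 3) / 2 : ℝ) + 1 = (3*j+5)/2 by ring,
      ← Real.Gamma_add_one (by positivity)]
    congr 1; push_cast; ring
  have g2 : Real.Gamma (((j + 2 : ℕ):ℝ) + 1) = (j+2) * ((j+1) * Real.Gamma (j+1)) := by
    rw [← Real.Gamma_add_one (by positivity), show (j + 1 : ℝ) + 1 = j + 2 by ring,
      ← Real.Gamma_add_one (by positivity)]
    congr 1; push_cast; ring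
  have g3 : Real.Gamma ((((j + 2 : ℕ):ℝ) + 3) / 2) = ((j+3)/2) * Real.Gamma ((j+3)/2) := by
    rw [← Real.Gamma_add_one (by positivity)]
    congr 1; push_cast; ring
  unfold aCoeff
  rw [g1, g2, g3]
  field_simp
  ring

theorem c_scale (s : ℝ) (j : ℕ) : aCoeff s j = s ^ (j+1) * aCoeff 1 j := by
  unfold aCoeff; simp only [one_pow]; ring

theorem c_bound (K : ℝ) (hK : K ^ 2 = 27 / 4) (hK0 : 0 < K) (j : ℕ) :
    aCoeff 1 j ≤ (72 * K) ^ j := by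
  induction j using Nat.strong_induction_on with
  | _ j ih =>
    match j with
    | 0 => simp [c_zero]
    | 1 => rw [c_one, pow_one]; nlinarith
    | (j+2) =>
      have h := ih j (by omega)
      have hr := c_rec j
      have hp := c_pos j
      have hstep : aCoeff 1 (j+2) ≤ 72^2 * (27/4) * aCoeff 1 j := by
        have hq : (0:ℝ) < 4 * ((j:ℝ)+2) * (j+3) := by positivity
        rw [← mul_le_mul_iff_right₀ hq, hr]
        have : (3 * (3 * j + 1) * (3 * j + 5) * 72 ^ 2 : ℝ) ≤ 4 * ((j:ℝ)+2) * (j+3) * (72^2 * (27/4)) := by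
          have : (0:ℝ) ≤ j := by positivity
          nlinarith
        calc _ ≤ _ := mul_le_mul_of_nonneg_right this hp.le
          _ = _ := by ring
      calc _ ≤ _ := hstep
        _ ≤ 72^2 * (27/4) * (72 * K) ^ j := by gcongr
        _ = _ := by rw [← hK]; ring

open PowerSeries in
theorem coeff_formal (H : PowerSeries ℂ) (h0 : coeff 0 H = 1) (hH : X * H ^ 3 - H ^ 2 + 1 = 0)
    (j : ℕ) : (aCoeff 1 j : ℂ) = 72 ^ j * coeff j H := by
  obtain ⟨h1, hr⟩ := formal_rec H h0 hH
  induction j using Nat.strong_induction_on with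
  | _ j ih =>
    match j with
    | 0 => rw [c_zero, h0]; simp
    | 1 => rw [c_one, h1]; push_cast; ring
    | (j+2) =>
      have h := ih j (by omega)
      have hc := congrArg (fun t : ℝ => (t : ℂ)) (c_rec j)
      push_cast at hc
      have hj := hr j
      have hq : 4 * ((j:ℂ)+2) * (j+3) ≠ 0 := by
        have : (4 * ((j:ℂ)+2) * (j+3)) = ((4 * (j+2) * (j+3) : ℕ) : ℂ) := by push_cast; ring
        rw [this, Nat.cast_ne_zero]; positivity
      apply mul_left_cancel₀ hq
      rw [hc, h]
      linear_combination (-72 ^ (j+2)) * hj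

open PowerSeries in
theorem eval_mul_s2 (A B : PowerSeries ℂ) (x : ℂ) (hA : Summable fun j => ‖coeff j A * x ^ j‖)
    (hB : Summable fun j => ‖coeff j B * x ^ j‖) :
    (Summable fun j => ‖coeff j (A * B) * x ^ j‖) ∧
    ∑' j, coeff j (A * B) * x ^ j = (∑' j, coeff j A * x ^ j) * ∑' j, coeff j B * x ^ j := by
  have e : ∀ j, coeff j (A * B) * x ^ j
      = ∑ kl ∈ Finset.HasAntidiagonal.antidiagonal j, (coeff kl.1 A * x ^ kl.1) * (coeff kl.2 B * x ^ kl.2) := by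
    intro j
    rw [coeff_mul, Finset.sum_mul]
    refine Finset.sum_congr rfl fun kl hkl => ?_
    rw [← Finset.HasAntidiagonal.mem_antidiagonal.1 hkl]; ring
  generalize hf : (fun j => coeff j A * x ^ j) = f at *
  generalize hg : (fun j => coeff j B * x ^ j) = g at *
  have hA' : Summable fun j => ‖f j‖ := by rw [← hf]; exact hA
  have hB' : Summable fun j => ‖g j‖ := by rw [← hg]; exact hB
  have e' : ∀ j, coeff j (A * B) * x ^ j
      = ∑ kl ∈ Finset.HasAntidiagonal.antidiagonal j, f kl.1 * g kl.2 := by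
    intro j; rw [e, ← hf, ← hg]
  simp only [e']
  have h1 := summable_norm_sum_mul_antidiagonal_of_summable_norm hA' hB'
  have h2 := tsum_mul_tsum_eq_tsum_sum_antidiagonal_of_summable_norm hA' hB'
  exact ⟨h1, h2.symm⟩

open PowerSeries in
theorem eval_formal (H : PowerSeries ℂ) (hH : X * H ^ 3 - H ^ 2 + 1 = 0) (x : ℂ)
    (hs : Summable fun j => ‖coeff j H * x ^ j‖) :
    x * (∑' j, coeff j H * x ^ j) ^ 3 - (∑' j, coeff j H * x ^ j) ^ 2 + 1 = 0 := by
  obtain ⟨s2, e2⟩ := eval_mul_s2 H H x hs hs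
  obtain ⟨s3, e3⟩ := eval_mul_s2 (H * H) H x s2 hs
  have z : ∀ j, j ∉ ({1} : Finset ℕ) → coeff j (X : PowerSeries ℂ) * x ^ j = 0 := by
    intro j hj
    rw [coeff_X, if_neg (by simpa using hj), zero_mul]
  have sX : Summable fun j => ‖coeff j (X : PowerSeries ℂ) * x ^ j‖ :=
    summable_of_ne_finset_zero (s := {1}) fun j hj => by rw [z j hj, norm_zero]
  have eX : ∑' j, coeff j (X : PowerSeries ℂ) * x ^ j = x := by
    rw [tsum_eq_sum z]; simp
  obtain ⟨s4, e4⟩ := eval_mul_s2 X (H * H * H) x sX s3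
  have z1 : ∀ j, j ∉ ({0} : Finset ℕ) → coeff j (1 : PowerSeries ℂ) * x ^ j = 0 := by
    intro j hj
    rw [coeff_one, if_neg (by simpa using hj), zero_mul]
  have s1 : Summable fun j => coeff j (1 : PowerSeries ℂ) * x ^ j :=
    summable_of_ne_finset_zero (s := {0}) z1
  have e1 : ∑' j, coeff j (1 : PowerSeries ℂ) * x ^ j = 1 := by
    rw [tsum_eq_sum z1]; simp
  have e5 : ∀ j, coeff j (H * H) * x ^ j = coeff j (X * (H * H * H)) * x ^ j + coeff j (1 : PowerSeries ℂ) * x ^ j := by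
    intro j
    rw [← add_mul, ← map_add]
    congr 2
    linear_combination -hH
  have e6 : ∑' j, coeff j (H * H) * x ^ j = ∑' j, (coeff j (X * (H * H * H)) * x ^ j + coeff j (1 : PowerSeries ℂ) * x ^ j) := tsum_congr e5
  rw [s4.of_norm.tsum_add s1, e1, e4, e3, e2, eX] at e6
  linear_combination -e6

theorem stmt2 (s : ℝ) (hs : 0 < s) (u : ℂ)
    (hu : ‖u‖ < (3 : ℝ) ^ ((1 : ℝ) / 4) / 18 * s ^ (-(1 : ℝ) / 2)) :
    Summable (fun j : ℕ => ‖(aCoeff s j : ℂ) * u ^ (2 * j)‖) ∧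
    72 * u ^ 2 * (∑' j : ℕ, (aCoeff s j : ℂ) * u ^ (2 * j)) ^ 3
      - (∑' j : ℕ, (aCoeff s j : ℂ) * u ^ (2 * j)) ^ 2 + (s : ℂ) ^ 2 = 0 := by
  obtain ⟨H, h0, hH⟩ := exists_formal
  set b : ℝ := (3 : ℝ) ^ ((1 : ℝ) / 4) with hb
  set t : ℝ := s ^ (-(1 : ℝ) / 2) with ht
  have hb0 : 0 < b := by positivity
  have ht0 : 0 < t := by positivity
  have hb4 : b ^ 4 = 3 := by
    rw [hb, ← Real.rpow_natCast, ← Real.rpow_mul (by norm_num)]; norm_num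
  have ht2 : s * t ^ 2 = 1 := by
    rw [ht, ← Real.rpow_natCast, ← Real.rpow_mul hs.le]; norm_num
    rw [Real.rpow_neg_one]; field_simp
  have hx : 72 * s * ‖u‖ ^ 2 * (3 * b ^ 2 / 2) < 1 := by
    have h1 : ‖u‖ ^ 2 < (b / 18 * t) ^ 2 := by gcongr
    calc _ < 72 * s * (b / 18 * t) ^ 2 * (3 * b ^ 2 / 2) := by gcongr
      _ = (s * t ^ 2) * (b ^ 4 / 3) := by ring
      _ = 1 := by rw [ht2, hb4]; norm_num
  have hterm : ∀ j, (aCoeff s j : ℂ) * u ^ (2 * j) = s * (PowerSeries.coeff j H * (72 * s * u ^ 2) ^ j) := by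
    intro j
    rw [c_scale]
    push_cast
    rw [coeff_formal H h0 hH]
    ring
  have hsum : Summable (fun j : ℕ => ‖PowerSeries.coeff j H * (72 * s * u ^ 2) ^ j‖) := by
    refine Summable.of_nonneg_of_le (fun _ => norm_nonneg _) (fun j => ?_)
      (summable_geometric_of_lt_one (by positivity) hx)
    have e : PowerSeries.coeff j H * (72 * s * u ^ 2) ^ j = (aCoeff 1 j : ℂ) * (s * u ^ 2) ^ j := by
      rw [coeff_formal H h0 hH]; ring
    have hcb := c_bound (3 * b ^ 2 / 2) (by linear_combination (9/4) * hb4) (by positivity) j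
    rw [e, norm_mul, norm_pow, norm_mul, norm_pow, Complex.norm_real, Complex.norm_real,
      Real.norm_of_nonneg (c_pos j).le, Real.norm_of_nonneg hs.le]
    calc _ ≤ (72 * (3 * b ^ 2 / 2)) ^ j * (s * ‖u‖ ^ 2) ^ j := by gcongr
      _ = _ := by rw [← mul_pow]; congr 1; ring
  simp only [hterm]
  refine ⟨?_, ?_⟩
  · simp only [norm_mul (s : ℂ)]
    exact hsum.mul_left _
  · rw [tsum_mul_left]
    linear_combination (s:ℂ)^2 * eval_formal H hH _ hsum
end

section
/- Let $u_c = \frac{3^{1/4}}{18}$. The power series $F^{(0)}(u) = \sum_{j=1}^{\infty} \frac{72^j\,\Gamma(\tfrac{3j}{2})}{2\,\Gamma(j+3)\,\Gamma(\tfrac{j}{2}+1)}\, u^{2j}$, where $\Gamma$ is the Euler Gamma function, has radius of convergence in $u$ equal to $u_c$; in particular it converges for every complex $u$ with $|u| < u_c$ and diverges for every complex $u$ with $|u| > u_c$. -/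
noncomputable def auxC (j : ℕ) : ℝ :=
  72 ^ (j + 1) * Real.Gamma (3 * (j + 1) / 2) /
          (2 * Real.Gamma ((j + 1) + 3) * Real.Gamma ((j + 1) / 2 + 1))

noncomputable def auxT (u : ℂ) (j : ℕ) : ℂ := ((auxC j : ℝ) : ℂ) * u ^ (2 * (j + 1))

noncomputable def auxR (j : ℕ) : ℝ :=
  34992 * ((((j : ℝ) + 1) / (j + 4)) * (((j : ℝ) + 5 / 3) / (j + 5)) * (((j : ℝ) + 7 / 3) / (j + 3)))

lemma auxC_pos (j : ℕ) : 0 < auxC j := by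
  unfold auxC
  have h1 : 0 < Real.Gamma (3 * ((j : ℝ) + 1) / 2) := Real.Gamma_pos_of_pos (by positivity)
  have h2 : 0 < Real.Gamma (((j : ℝ) + 1) + 3) := Real.Gamma_pos_of_pos (by positivity)
  have h3 : 0 < Real.Gamma (((j : ℝ) + 1) / 2 + 1) := Real.Gamma_pos_of_pos (by positivity)
  positivity

lemma auxC_step (j : ℕ) : auxC (j + 2) = auxR j * auxC j := by
  unfold auxC auxR
  have h1 : 0 < Real.Gamma (3 * ((j : ℝ) + 1) / 2) := Real.Gamma_pos_of_pos (by positivity)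
  have h2 : 0 < Real.Gamma (((j : ℝ) + 1) + 3) := Real.Gamma_pos_of_pos (by positivity)
  have h3 : 0 < Real.Gamma (((j : ℝ) + 1) / 2 + 1) := Real.Gamma_pos_of_pos (by positivity)
  have e1 : Real.Gamma (3 * (((j + 2 : ℕ) : ℝ) + 1) / 2) =
      (3 * ((j : ℝ) + 1) / 2 + 1 + 1) * ((3 * ((j : ℝ) + 1) / 2 + 1) *
        ((3 * ((j : ℝ) + 1) / 2) * Real.Gamma (3 * ((j : ℝ) + 1) / 2))) := by
    rw [← Real.Gamma_add_one (by positivity), ← Real.Gamma_add_one (by positivity),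
      ← Real.Gamma_add_one (by positivity)]
    congr 1; push_cast; ring
  have e2 : Real.Gamma ((((j + 2 : ℕ) : ℝ) + 1) + 3) =
      (((j : ℝ) + 1) + 3 + 1) * ((((j : ℝ) + 1) + 3) * Real.Gamma (((j : ℝ) + 1) + 3)) := by
    rw [← Real.Gamma_add_one (by positivity), ← Real.Gamma_add_one (by positivity)]
    congr 1; push_cast; ring
  have e3 : Real.Gamma ((((j + 2 : ℕ) : ℝ) + 1) / 2 + 1) =
      (((j : ℝ) + 1) / 2 + 1) * Real.Gamma (((j : ℝ) + 1) / 2 + 1) := by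
    rw [← Real.Gamma_add_one (by positivity)]
    congr 1; push_cast; ring
  rw [e1, e2, e3]
  generalize Real.Gamma (3 * ((j : ℝ) + 1) / 2) = a at *
  generalize Real.Gamma (((j : ℝ) + 1) + 3) = b at *
  generalize Real.Gamma (((j : ℝ) + 1) / 2 + 1) = c at *
  have p3 : (j : ℝ) + 3 ≠ 0 := by positivity
  have p4 : (j : ℝ) + 4 ≠ 0 := by positivity
  have p5 : (j : ℝ) + 5 ≠ 0 := by positivity
  have q4 : (j : ℝ) + 1 + 3 = j + 4 := by ring
  have q5 : (j : ℝ) + 4 + 1 = j + 5 := by ring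
  have q3 : ((j : ℝ) + 1) / 2 + 1 = (j + 3) / 2 := by ring
  rw [q4, q5, q3]
  field_simp
  ring

lemma aux_lim (a b : ℝ) (hb : 0 < b) :
    Filter.Tendsto (fun j : ℕ => ((j : ℝ) + a) / (j + b)) Filter.atTop (nhds 1) := by
  have h : Filter.Tendsto (fun j : ℕ => 1 + (a - b) / ((j : ℝ) + b)) Filter.atTop
      (nhds (1 + 0)) := by
    refine tendsto_const_nhds.add (tendsto_const_nhds.div_atTop ?_)
    exact Filter.tendsto_atTop_add_const_right _ _ tendsto_natCast_atTop_atTop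
  rw [add_zero] at h
  refine h.congr fun j => ?_
  have : (j : ℝ) + b ≠ 0 := by positivity
  field_simp
  ring

lemma auxR_lim : Filter.Tendsto auxR Filter.atTop (nhds 34992) := by
  have h := (((aux_lim 1 4 (by norm_num)).mul (aux_lim (5 / 3) 5 (by norm_num))).mul
    (aux_lim (7 / 3) 3 (by norm_num))).const_mul 34992
  simp only [mul_one] at h
  exact h

lemma auxT_ne (u : ℂ) (hu : u ≠ 0) (j : ℕ) : auxT u j ≠ 0 :=
  mul_ne_zero (by exact_mod_cast (auxC_pos j).ne') (pow_ne_zero _ hu)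

lemma auxR_nonneg (j : ℕ) : 0 ≤ auxR j := by unfold auxR; positivity

lemma auxT_ratio (u : ℂ) (hu : u ≠ 0) (j : ℕ) :
    ‖auxT u (j + 2)‖ / ‖auxT u j‖ = auxR j * ‖u‖ ^ 4 := by
  rw [div_eq_iff (norm_ne_zero_iff.mpr (auxT_ne u hu j))]
  have : auxT u (j + 2) = ((auxR j : ℝ) : ℂ) * u ^ 4 * auxT u j := by
    unfold auxT
    rw [auxC_step]
    push_cast
    ring
  rw [this, norm_mul, norm_mul, norm_pow, Complex.norm_real, Real.norm_of_nonneg (auxR_nonneg j)]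

lemma auxT_lim (u : ℂ) (hu : u ≠ 0) (k : ℕ) :
    Filter.Tendsto (fun i : ℕ => ‖auxT u (2 * (i + 1) + k)‖ / ‖auxT u (2 * i + k)‖) Filter.atTop
      (nhds (34992 * ‖u‖ ^ 4)) := by
  have h : Filter.Tendsto (fun i : ℕ => 2 * i + k) Filter.atTop Filter.atTop :=
    Filter.tendsto_atTop_mono (fun i => by simp only [id]; omega) Filter.tendsto_id
  refine ((auxR_lim.mul_const (‖u‖ ^ 4)).comp h).congr fun i => ?_
  have e : 2 * (i + 1) + k = (2 * i + k) + 2 := by ring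
  rw [e, auxT_ratio u hu]
  rfl

lemma aux_uc : ((3 : ℝ) ^ ((1 : ℝ) / 4) / 18) ^ 4 = 1 / 34992 := by
  rw [div_pow, ← Real.rpow_natCast, ← Real.rpow_mul (by norm_num)]
  norm_num

lemma aux_conv (u : ℂ) (h : ‖u‖ < (3 : ℝ) ^ ((1 : ℝ) / 4) / 18) : Summable (auxT u) := by
  by_cases hu : u = 0
  · have : auxT u = fun _ => 0 := by
      funext j
      simp [auxT, hu]
    rw [this]
    exact summable_zero
  have h4 : 34992 * ‖u‖ ^ 4 < 1 := by
    have := pow_lt_pow_left₀ h (norm_nonneg u) (n := 4) (by norm_num)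
    rw [aux_uc] at this
    linarith
  have key : ∀ k : ℕ, Summable (fun i : ℕ => auxT u (2 * i + k)) := fun k =>
    summable_of_ratio_test_tendsto_lt_one h4
      (Filter.Eventually.of_forall fun i => auxT_ne u hu _) (auxT_lim u hu k)
  exact ((key 0).hasSum.even_add_odd (key 1).hasSum).summable

lemma aux_div (u : ℂ) (h : (3 : ℝ) ^ ((1 : ℝ) / 4) / 18 < ‖u‖) : ¬ Summable (auxT u) := by
  intro hs
  have hu : u ≠ 0 := by
    rintro rfl
    rw [norm_zero] at h
    have : (0 : ℝ) < (3 : ℝ) ^ ((1 : ℝ) / 4) / 18 := by positivity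
    linarith
  have h4 : 1 < 34992 * ‖u‖ ^ 4 := by
    have := pow_lt_pow_left₀ h (by positivity) (n := 4) (by norm_num)
    rw [aux_uc] at this
    linarith
  have hinj : Function.Injective (fun i : ℕ => 2 * i + 0) := fun a b hab => by
    simp only at hab
    omega
  have hs2 : Summable (fun i : ℕ => auxT u (2 * i + 0)) := hs.comp_injective hinj
  have hn : ¬ Summable (fun i : ℕ => auxT u (2 * i + 0)) :=
    not_summable_of_ratio_test_tendsto_gt_one h4 (auxT_lim u hu 0)
  exact hn hs2

/-- The power series `F⁽⁰⁾(u) = ∑_{j≥1} (72^j Γ(3j/2) / (2 Γ(j+3) Γ(j/2+1))) u^{2j}` has radius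
of convergence `u_c = 3^{1/4}/18` in `u`: it converges (absolutely) for every complex `u` with
`|u| < u_c` and diverges for every complex `u` with `|u| > u_c`. -/
theorem stmt13 :
    (∀ u : ℂ, ‖u‖ < (3 : ℝ) ^ ((1 : ℝ) / 4) / 18 →
      Summable (fun j : ℕ =>
        ((72 ^ (j + 1) * Real.Gamma (3 * (j + 1) / 2) /
          (2 * Real.Gamma ((j + 1) + 3) * Real.Gamma ((j + 1) / 2 + 1)) : ℝ) : ℂ) *
          u ^ (2 * (j + 1)))) ∧
    (∀ u : ℂ, (3 : ℝ) ^ ((1 : ℝ) / 4) / 18 < ‖u‖ →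
      ¬ Summable (fun j : ℕ =>
        ((72 ^ (j + 1) * Real.Gamma (3 * (j + 1) / 2) /
          (2 * Real.Gamma ((j + 1) + 3) * Real.Gamma ((j + 1) / 2 + 1)) : ℝ) : ℂ) *
          u ^ (2 * (j + 1)))) := by
  exact ⟨aux_conv, aux_div⟩
end
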